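/- arXiv:1602.00897 — 8 statements merged into one kernel-verified Lean document; each statement's English description precedes it below -/
import Mathlib

section
/- (Flow property of the Skorohod reflection.) Let x ≥ 0, let f : [0,∞) → ℝ be continuous with f(0) = 0, and let 0 ≤ s ≤ t. Set ξ = X^{x,f}(s) and define the shifted path g : [0,∞) → ℝ by g(u) = f(s + u) − f(s). Then X^{x,f}(t) = X^{ξ,g}(t − s) and L^{x,f}(t) = L^{x,f}(s) + L^{ξ,g}(t − s). -/
open MeasureTheory Filter Topology

/-- The reflection (local time) term of the Skorohod problem:
`L^{x,f}(t) = sup_{s ∈ [0,t]} max (-(x + f s)) 0`. -/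
noncomputable def skL (x : ℝ) (f : ℝ → ℝ) (t : ℝ) : ℝ :=
  sSup ((fun s => max (-(x + f s)) 0) '' Set.Icc 0 t)

/-- The reflected path `X^{x,f} = x + f + L^{x,f}`. -/
noncomputable def skX (x : ℝ) (f : ℝ → ℝ) (t : ℝ) : ℝ :=
  x + f t + skL x f t

theorem max_le_skL (x : ℝ) {f : ℝ → ℝ} {r t : ℝ} (hf : ContinuousOn f (Set.Icc 0 t))
    (hr : r ∈ Set.Icc 0 t) : max (-(x + f r)) 0 ≤ skL x f t := by
  have hc : ContinuousOn (fun s => max (-(x + f s)) 0) (Set.Icc 0 t) := by fun_prop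
  exact le_csSup (isCompact_Icc.image_of_continuousOn hc).bddAbove ⟨r, hr, rfl⟩

theorem skL_le (x : ℝ) {f : ℝ → ℝ} {t b : ℝ} (ht : 0 ≤ t)
    (hb : ∀ r ∈ Set.Icc 0 t, max (-(x + f r)) 0 ≤ b) : skL x f t ≤ b :=
  csSup_le ((Set.nonempty_Icc.2 ht).image _) (Set.forall_mem_image.2 hb)

theorem skL_eq_add_skL_shift (x : ℝ) {f : ℝ → ℝ} {s t : ℝ}
    (hf : ContinuousOn f (Set.Icc 0 t)) (hs : 0 ≤ s) (hst : s ≤ t) :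
    skL x f t = skL x f s + skL (skX x f s) (fun u => f (s + u) - f s) (t - s) := by
  have hfs : ContinuousOn f (Set.Icc 0 s) := hf.mono (Set.Icc_subset_Icc_right hst)
  have hg : ContinuousOn (fun u => f (s + u) - f s) (Set.Icc 0 (t - s)) := by
    refine (hf.comp (by fun_prop) fun u hu => ?_).sub continuousOn_const
    exact ⟨by linarith [hu.1], by linarith [hu.2]⟩
  have hts : 0 ≤ t - s := sub_nonneg.2 hst
  have hL : 0 ≤ skL x f s := (le_max_right _ _).trans (max_le_skL x hfs ⟨hs, le_rfl⟩)
  apply le_antisymm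
  · have hL' : 0 ≤ skL (skX x f s) (fun u => f (s + u) - f s) (t - s) :=
      (le_max_right _ _).trans (max_le_skL _ hg ⟨hts, le_rfl⟩)
    refine skL_le x (hs.trans hst) fun r hr => ?_
    rcases le_total r s with hrs | hrs
    · linarith [max_le_skL x hfs ⟨hr.1, hrs⟩]
    · have h := (le_max_left _ _).trans
        (max_le_skL (skX x f s) hg (r := r - s) ⟨sub_nonneg.2 hrs, by linarith [hr.2]⟩)
      simp only [add_sub_cancel, skX] at h ⊢
      exact max_le (by linarith) (by simp only [skX] at hL'; linarith)
  · have hLt : skL x f s ≤ skL x f t :=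
      skL_le x hs fun r hr => max_le_skL x hf ⟨hr.1, hr.2.trans hst⟩
    rw [← le_sub_iff_add_le']
    refine skL_le _ hts fun u hu => max_le ?_ (sub_nonneg.2 hLt)
    have h := (le_max_left _ _).trans
      (max_le_skL x hf (r := s + u) ⟨by linarith [hu.1], by linarith [hu.2]⟩)
    simp only [skX]
    linarith

/-- flow property of the Skorohod reflection. For `0 ≤ s ≤ t`, with
`ξ = X^{x,f}(s)` and the shifted path `g(u) = f(s+u) - f(s)`, one has
`X^{x,f}(t) = X^{ξ,g}(t-s)` and `L^{x,f}(t) = L^{x,f}(s) + L^{ξ,g}(t-s)`. -/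
theorem statement3 (x : ℝ) (hx : 0 ≤ x) (f : ℝ → ℝ)
    (hf : ContinuousOn f (Set.Ici 0)) (hf0 : f 0 = 0)
    (s t : ℝ) (hs : 0 ≤ s) (hst : s ≤ t) :
    skX x f t = skX (skX x f s) (fun u => f (s + u) - f s) (t - s) ∧
    skL x f t = skL x f s + skL (skX x f s) (fun u => f (s + u) - f s) (t - s) := by
  have h := skL_eq_add_skL_shift x (hf.mono Set.Icc_subset_Ici_self) hs hst
  refine ⟨?_, h⟩
  rw [skX, h, skX.eq_1 (skX x f s), add_sub_cancel]
  nth_rw 2 [skX]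
  ring
end

section
/- (Coalescence of Skorohod reflections.) Let f : [0,∞) → ℝ be continuous with f(0) = 0, let 0 < x < y, and assume τ^{y,f} < ∞. Then: (i) for every t < τ^{x,f}, X^{y,f}(t) − X^{x,f}(t) = y − x; (ii) L^{y,f}(τ^{y,f}) = 0 and L^{x,f}(τ^{y,f}) = y − x; (iii) X^{x,f}(τ^{y,f}) = X^{y,f}(τ^{y,f}) = 0 and X^{x,f}(t) = X^{y,f}(t) for all t ≥ τ^{y,f}; (iv) the first meeting time satisfies inf{t > 0 : X^{x,f}(t) = X^{y,f}(t)} = τ^{y,f}. -/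
open MeasureTheory Filter Topology
open scoped ENNReal

/-- The first hitting time of `0` by `X^{x,f}`: `τ^{x,f} = inf {t > 0 : X^{x,f}(t) = 0}`,
taken in `ℝ≥0∞` so that the infimum of the empty set is `∞`. -/
noncomputable def skTau (x : ℝ) (f : ℝ → ℝ) : ℝ≥0∞ :=
  ⨅ (t : ℝ) (_ : 0 < t) (_ : skX x f t = 0), ENNReal.ofReal t

lemma isGreatest_skL {f : ℝ → ℝ} (hf : ContinuousOn f (Set.Ici 0)) (x : ℝ) {t : ℝ}
    (ht : 0 ≤ t) :
    IsGreatest ((fun s => max (-(x + f s)) 0) '' Set.Icc 0 t) (skL x f t) := by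
  have hc : ContinuousOn f (Set.Icc 0 t) := hf.mono Set.Icc_subset_Ici_self
  exact (isCompact_Icc.image_of_continuousOn (by fun_prop)).isGreatest_sSup
    ((Set.nonempty_Icc.2 ht).image _)

lemma neg_le_skL {f : ℝ → ℝ} (hf : ContinuousOn f (Set.Ici 0)) (x : ℝ) {s t : ℝ}
    (hs : 0 ≤ s) (hst : s ≤ t) : -(x + f s) ≤ skL x f t :=
  (le_max_left _ _).trans
    ((isGreatest_skL hf x (hs.trans hst)).2 (Set.mem_image_of_mem _ ⟨hs, hst⟩))

lemma skL_nonneg (x : ℝ) (f : ℝ → ℝ) (t : ℝ) : 0 ≤ skL x f t := by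
  refine Real.sSup_nonneg ?_
  rintro _ ⟨s, -, rfl⟩
  exact le_max_right _ _

/-- The supremum defining `skL` is attained. -/
lemma exists_skL_eq {f : ℝ → ℝ} (hf : ContinuousOn f (Set.Ici 0)) (x : ℝ) {t : ℝ}
    (ht : 0 ≤ t) : ∃ s, 0 ≤ s ∧ s ≤ t ∧ skL x f t = max (-(x + f s)) 0 := by
  obtain ⟨s, hs, h⟩ := (isGreatest_skL hf x ht).1
  exact ⟨s, hs.1, hs.2, h.symm⟩

lemma skL_eq_zero {f : ℝ → ℝ} (hf : ContinuousOn f (Set.Ici 0)) {x t : ℝ} (ht : 0 ≤ t)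
    (h : ∀ u, 0 ≤ u → u ≤ t → 0 ≤ x + f u) : skL x f t = 0 := by
  obtain ⟨s, hs0, hst, hs⟩ := exists_skL_eq hf x ht
  rw [hs, max_eq_right (neg_nonpos.2 (h s hs0 hst))]

lemma add_nonpos_of_skX_eq_zero {f : ℝ → ℝ} {x t : ℝ} (h : skX x f t = 0) :
    x + f t ≤ 0 := by
  have := skL_nonneg x f t
  unfold skX at h
  linarith

/-- A continuous path started above level `-x` that reaches it has a first hitting time. -/
lemma exists_first_hit {f : ℝ → ℝ} (hf : ContinuousOn f (Set.Ici 0)) (hf0 : f 0 = 0)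
    {x s : ℝ} (hx : 0 < x) (hs : 0 ≤ s) (hfs : x + f s ≤ 0) :
    ∃ T, 0 < T ∧ T ≤ s ∧ x + f T = 0 ∧ ∀ u, 0 ≤ u → u < T → 0 < x + f u := by
  have hc : ContinuousOn (fun u => x + f u) (Set.Icc 0 s) :=
    continuousOn_const.add (hf.mono Set.Icc_subset_Ici_self)
  have hclosed : IsClosed (Set.Icc 0 s ∩ (fun u => x + f u) ⁻¹' Set.Iic 0) :=
    hc.preimage_isClosed_of_isClosed isClosed_Icc isClosed_Iic
  have hcomp := isCompact_Icc.of_isClosed_subset hclosed Set.inter_subset_left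
  obtain ⟨T, ⟨⟨hT0, hTs⟩, hT⟩, hmin⟩ := hcomp.exists_isLeast ⟨s, ⟨hs, le_rfl⟩, hfs⟩
  have hT' : x + f T ≤ 0 := hT
  have hpos : ∀ u, 0 ≤ u → u < T → 0 < x + f u := fun u hu huT => by
    by_contra! h
    exact huT.not_ge (hmin ⟨⟨hu, huT.le.trans hTs⟩, h⟩)
  obtain ⟨r, ⟨hr0, hrT⟩, hr⟩ := intermediate_value_Icc' hT0
    (hc.mono (Set.Icc_subset_Icc_right hTs)) ⟨hT', by simp [hf0, hx.le]⟩
  have hr : x + f r = 0 := hr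
  obtain rfl : r = T := hrT.eq_of_not_lt fun h => (hpos r hr0 h).ne' hr
  refine ⟨r, hr0.lt_of_ne ?_, hTs, hr, hpos⟩
  rintro rfl
  linarith

lemma skTau_eq_ofReal {f : ℝ → ℝ} (hf : ContinuousOn f (Set.Ici 0)) {x T : ℝ} (hT : 0 < T)
    (hfT : x + f T = 0) (hpos : ∀ u, 0 ≤ u → u < T → 0 < x + f u) :
    skTau x f = ENNReal.ofReal T := by
  have hL : skL x f T = 0 := skL_eq_zero hf hT.le fun u hu huT =>
    huT.lt_or_eq.elim (fun h => (hpos u hu h).le) (fun h => h ▸ hfT.ge)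
  refine le_antisymm (iInf₂_le_of_le T hT (iInf_le _ (by simp [skX, hfT, hL]))) ?_
  refine le_iInf₂ fun t ht => le_iInf fun h => ENNReal.ofReal_le_ofReal ?_
  by_contra! htT
  exact (hpos t ht.le htT).not_ge (add_nonpos_of_skX_eq_zero h)

lemma add_nonneg_of_lt_skTau {f : ℝ → ℝ} (hf : ContinuousOn f (Set.Ici 0)) (hf0 : f 0 = 0)
    {x u : ℝ} (hx : 0 < x) (hu : 0 ≤ u) (h : ENNReal.ofReal u < skTau x f) :
    0 ≤ x + f u := by
  by_contra! hneg
  obtain ⟨T, hT, hTu, hfT, hpos⟩ := exists_first_hit hf hf0 hx hu hneg.le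
  rw [skTau_eq_ofReal hf hT hfT hpos] at h
  exact h.not_ge (ENNReal.ofReal_le_ofReal hTu)

/-- Once the lower path has been pushed up by `y - x`, the reflection terms differ by `y - x`. -/
lemma skL_eq_add_skL {f : ℝ → ℝ} (hf : ContinuousOn f (Set.Ici 0)) {x y T t : ℝ}
    (hxy : x ≤ y) (hT : 0 ≤ T) (hfT : y + f T = 0) (hTt : T ≤ t) :
    skL x f t = y - x + skL y f t := by
  apply le_antisymm
  · obtain ⟨s, hs0, hst, hs⟩ := exists_skL_eq hf x (hT.trans hTt)
    rw [hs]
    have h1 := neg_le_skL hf y hs0 hst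
    have h2 := skL_nonneg y f t
    exact max_le (by linarith) (by linarith)
  · obtain ⟨s, hs0, hst, hs⟩ := exists_skL_eq hf y (hT.trans hTt)
    have h1 := neg_le_skL hf x hs0 hst
    have h2 := neg_le_skL hf x hT hTt
    have h3 : max (-(y + f s)) 0 ≤ skL x f t - (y - x) :=
      max_le (by linarith) (by linarith)
    linarith

/-- coalescence of Skorohod reflections. For `0 < x < y` with
`τ^{y,f} < ∞`: (i) `X^{y,f} - X^{x,f} = y - x` before `τ^{x,f}`;
(ii) `L^{y,f}(τ^{y,f}) = 0` and `L^{x,f}(τ^{y,f}) = y - x`;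
(iii) `X^{x,f}(τ^{y,f}) = X^{y,f}(τ^{y,f}) = 0` and the two reflected paths agree after
`τ^{y,f}`; (iv) the first meeting time of the two paths equals `τ^{y,f}`. -/
theorem statement4 (f : ℝ → ℝ) (hf : ContinuousOn f (Set.Ici 0)) (hf0 : f 0 = 0)
    (x y : ℝ) (hx : 0 < x) (hxy : x < y) (hfin : skTau y f < ⊤) :
    (∀ t : ℝ, 0 ≤ t → ENNReal.ofReal t < skTau x f →
      skX y f t - skX x f t = y - x) ∧
    skL y f (skTau y f).toReal = 0 ∧
    skL x f (skTau y f).toReal = y - x ∧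
    skX x f (skTau y f).toReal = 0 ∧
    skX y f (skTau y f).toReal = 0 ∧
    (∀ t : ℝ, (skTau y f).toReal ≤ t → skX x f t = skX y f t) ∧
    (⨅ (t : ℝ) (_ : 0 < t) (_ : skX x f t = skX y f t), ENNReal.ofReal t) = skTau y f := by
  obtain ⟨s, hs, hXs⟩ : ∃ s, 0 < s ∧ skX y f s = 0 := by
    simpa [skTau, iInf_lt_iff] using hfin
  obtain ⟨T, hT, -, hfT, hpos⟩ :=
    exists_first_hit hf hf0 (hx.trans hxy) hs.le (add_nonpos_of_skX_eq_zero hXs)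
  have htau := skTau_eq_ofReal hf hT hfT hpos
  have hLy : ∀ t, 0 ≤ t → t ≤ T → skL y f t = 0 := fun t ht htT =>
    skL_eq_zero hf ht fun u hu hut =>
      (hut.trans htT).lt_or_eq.elim (fun h => (hpos u hu h).le) (fun h => h ▸ hfT.ge)
  have hLyT := hLy T hT.le le_rfl
  have hLxT : skL x f T = y - x := by
    rw [skL_eq_add_skL hf hxy.le hT.le hfT le_rfl, hLyT, add_zero]
  have hmeet : ∀ t, T ≤ t → skX x f t = skX y f t := fun t ht => by
    unfold skX
    linarith [skL_eq_add_skL hf hxy.le hT.le hfT ht]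
  have hXy : skX y f T = 0 := by simp [skX, hfT, hLyT]
  rw [htau, ENNReal.toReal_ofReal hT.le]
  refine ⟨fun t ht htx => ?_, hLyT, hLxT, (hmeet T le_rfl).trans hXy, hXy, hmeet,
    le_antisymm (iInf₂_le_of_le T hT (iInf_le _ (hmeet T le_rfl))) ?_⟩
  · have hfx : ∀ u, 0 ≤ u → u ≤ t → 0 ≤ x + f u := fun u hu hut =>
      add_nonneg_of_lt_skTau hf hf0 hx hu ((ENNReal.ofReal_le_ofReal hut).trans_lt htx)
    have h1 := skL_eq_zero hf ht hfx
    have h2 : skL y f t = 0 := skL_eq_zero hf ht fun u hu hut => by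
      linarith [hfx u hu hut]
    unfold skX
    linarith
  · refine le_iInf₂ fun t ht => le_iInf fun h => ENNReal.ofReal_le_ofReal ?_
    by_contra! htT
    obtain ⟨r, hr0, hrt, hr⟩ := exists_skL_eq hf x ht.le
    have h1 := hpos r hr0 (hrt.trans_lt htT)
    have h2 : max (-(x + f r)) 0 < y - x := max_lt (by linarith) (by linarith)
    have h3 := hLy t ht.le htT.le
    unfold skX at h
    linarith
end

section
/- Let f : [0,∞) → ℝ be continuous with f(0) = 0, let x > 0 and t ≥ 0. Then X^{x + L^{x,f}(t), f}(t) = X^{x,f}(t); that is, shifting the starting point upward by the accumulated reflection term L^{x,f}(t) does not change the value of the Skorohod reflection at time t. -/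
open MeasureTheory Filter Topology

/-- The reflection term at time `t` dominates the deficit `-(x + f s)` at all earlier times. -/
theorem neg_add_le_skL {f : ℝ → ℝ} (hf : ContinuousOn f (Set.Ici 0)) (x : ℝ) {s t : ℝ}
    (hs : s ∈ Set.Icc 0 t) : -(x + f s) ≤ skL x f t := by
  have hcont : ContinuousOn (fun s => max (-(x + f s)) 0) (Set.Icc 0 t) := by
    have hf' : ContinuousOn f (Set.Icc 0 t) := hf.mono Set.Icc_subset_Ici_self
    fun_prop
  exact (le_max_left _ _).trans
    (le_csSup (isCompact_Icc.image_of_continuousOn hcont).bddAbove (Set.mem_image_of_mem _ hs))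

/-- Starting from `x + L^{x,f}(t)`, no reflection occurs up to time `t`. -/
theorem skL_add_skL {f : ℝ → ℝ} (hf : ContinuousOn f (Set.Ici 0)) (x : ℝ) {t : ℝ}
    (ht : 0 ≤ t) : skL (x + skL x f t) f t = 0 := by
  have hzero : (fun s => max (-(x + skL x f t + f s)) 0) '' Set.Icc 0 t = {0} := by
    rw [← (Set.nonempty_Icc.2 ht).image_const (0 : ℝ)]
    refine Set.image_congr fun s hs => max_eq_right ?_
    linarith [neg_add_le_skL hf x hs]
  rw [skL, hzero, csSup_singleton]

/-- shifting the starting point upward by the accumulated reflection term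
`L^{x,f}(t)` does not change the value of the Skorohod reflection at time `t`:
`X^{x + L^{x,f}(t), f}(t) = X^{x,f}(t)`. -/
theorem statement5 (f : ℝ → ℝ) (hf : ContinuousOn f (Set.Ici 0)) (hf0 : f 0 = 0)
    (x : ℝ) (hx : 0 < x) (t : ℝ) (ht : 0 ≤ t) :
    skX (x + skL x f t) f t = skX x f t := by
  rw [skX, skL_add_skL hf x ht, skX]
  ring
end

section
/- (Derivative of the Skorohod reflection in the starting point.) Let f : [0,∞) → ℝ be continuous with f(0) = 0, let x > 0 and t ≥ 0. (i) If t < τ^{x,f}, then there exists ε > 0 such that X^{z,f}(t) = X^{x,f}(t) + (z − x) for every z ∈ (x − ε, x + ε); in particular the map z ↦ X^{z,f}(t) has derivative 1 at x. (ii) If τ^{x,f} < t and L^{x,f}(t) > 0, then there exists ε > 0 such that X^{z,f}(t) = X^{x,f}(t) for every z ∈ (x − ε, x + ε); in particular the map z ↦ X^{z,f}(t) has derivative 0 at x. -/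
open MeasureTheory Filter Topology
open scoped ENNReal

/-- The reflection term is determined by the minimum of the path. -/
theorem skL_eq_of_isMinOn {f : ℝ → ℝ} {s t : ℝ} (hs : s ∈ Set.Icc 0 t)
    (hmin : IsMinOn f (Set.Icc 0 t) s) (z : ℝ) : skL z f t = max (-(z + f s)) 0 := by
  refine IsGreatest.csSup_eq ⟨⟨s, hs, rfl⟩, ?_⟩
  rintro _ ⟨r, hr, rfl⟩
  have := isMinOn_iff.mp hmin r hr
  exact max_le_max (by linarith) le_rfl

/-- Before the first hitting time of `0` the unreflected path stays positive. -/
theorem pos_of_lt_skTau {f : ℝ → ℝ} (hf0 : f 0 = 0) {x s t : ℝ} (hx : 0 < x)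
    (hs : s ∈ Set.Icc 0 t) (hmin : IsMinOn f (Set.Icc 0 t) s)
    (ht : ENNReal.ofReal t < skTau x f) : 0 < x + f s := by
  by_contra! h
  have hs0 : 0 < s := hs.1.lt_of_ne (by rintro rfl; linarith)
  have hX : skX x f s = 0 := by
    rw [skX, skL_eq_of_isMinOn ⟨hs.1, le_rfl⟩
      (hmin.on_subset (Set.Icc_subset_Icc_right hs.2)), max_eq_left (by linarith)]
    ring
  have hτ : skTau x f ≤ ENNReal.ofReal s := iInf₂_le_of_le s hs0 (iInf_le _ hX)
  exact (ht.trans_le hτ).not_ge (ENNReal.ofReal_le_ofReal hs.2)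

/-- derivative of the Skorohod reflection in the starting point.
(i) If `t < τ^{x,f}` then `X^{z,f}(t) = X^{x,f}(t) + (z - x)` for `z` near `x`, so
`z ↦ X^{z,f}(t)` has derivative `1` at `x`. (ii) If `τ^{x,f} < t` and `L^{x,f}(t) > 0`,
then `X^{z,f}(t) = X^{x,f}(t)` for `z` near `x`, so the derivative at `x` is `0`. -/
theorem statement6 (f : ℝ → ℝ) (hf : ContinuousOn f (Set.Ici 0)) (hf0 : f 0 = 0)
    (x : ℝ) (hx : 0 < x) (t : ℝ) (ht : 0 ≤ t) :
    (ENNReal.ofReal t < skTau x f →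
      (∃ ε > 0, ∀ z ∈ Set.Ioo (x - ε) (x + ε),
        skX z f t = skX x f t + (z - x)) ∧
      HasDerivAt (fun z => skX z f t) 1 x) ∧
    (skTau x f < ENNReal.ofReal t → 0 < skL x f t →
      (∃ ε > 0, ∀ z ∈ Set.Ioo (x - ε) (x + ε), skX z f t = skX x f t) ∧
      HasDerivAt (fun z => skX z f t) 0 x) := by
  obtain ⟨s, hs, hmin⟩ := isCompact_Icc.exists_isMinOn (Set.nonempty_Icc.mpr ht)
    (hf.mono Set.Icc_subset_Ici_self)
  have hL := skL_eq_of_isMinOn hs hmin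
  have near {ε : ℝ} (hε : 0 < ε) : Set.Ioo (x - ε) (x + ε) ∈ 𝓝 x :=
    Ioo_mem_nhds (by linarith) (by linarith)
  refine ⟨fun hτ => ?_, fun _ hpos => ?_⟩
  · have hxs := pos_of_lt_skTau hf0 hx hs hmin hτ
    have key : ∀ z ∈ Set.Ioo (x - (x + f s)) (x + (x + f s)),
        skX z f t = skX x f t + (z - x) := by
      intro z hz
      rw [skX, skX, hL, hL, max_eq_right (by linarith [hz.1]), max_eq_right (by linarith)]
      ring
    exact ⟨⟨_, hxs, key⟩, (((hasDerivAt_id x).sub_const x).const_add _).congr_of_eventuallyEq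
      (eventually_of_mem (near hxs) key)⟩
  · have hxs : 0 < -(x + f s) := by simpa [hL] using hpos
    have key : ∀ z ∈ Set.Ioo (x - -(x + f s)) (x + -(x + f s)), skX z f t = skX x f t := by
      intro z hz
      rw [skX, skX, hL, hL, max_eq_left (by linarith [hz.2]), max_eq_left hxs.le]
      ring
    exact ⟨⟨_, hxs, key⟩, (hasDerivAt_const x _).congr_of_eventuallyEq
      (eventually_of_mem (near hxs) key)⟩
end

section
/- For every y > 0 one has A(y) + y·A′(y) < 0, where A′ is the derivative of A. Consequently, for every fixed x > 0 the map a ↦ b_a(x) = (1/√a)·A(x/√a) is strictly increasing on (0,∞); equivalently, ∂_a ∂_x log u^a(x) > 0 for all a > 0 and x > 0. -/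
open MeasureTheory Filter Topology

/-- `φ(x) = ∫_0^x exp(-y²/2) dy`. -/
noncomputable def phi (x : ℝ) : ℝ := ∫ y in (0:ℝ)..x, Real.exp (-(y ^ 2) / 2)

/-- `A(x) = exp(-x²/2) / φ(x)`, the derivative of `log φ` on `(0,∞)`. -/
noncomputable def Afun (x : ℝ) : ℝ := Real.exp (-(x ^ 2) / 2) / phi x

/-- `b_a(x) = (1/√a)·A(x/√a)`, the derivative of `log u^a` on `(0,∞)`. -/
noncomputable def ba (a x : ℝ) : ℝ := (1 / Real.sqrt a) * Afun (x / Real.sqrt a)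

theorem hasDerivAt_phi (x : ℝ) : HasDerivAt phi (Real.exp (-(x ^ 2) / 2)) x := by
  have hc : Continuous fun y : ℝ => Real.exp (-(y ^ 2) / 2) := by fun_prop
  exact hc.integral_hasStrictDerivAt 0 x |>.hasDerivAt

theorem phi_pos {x : ℝ} (hx : 0 < x) : 0 < phi x := by
  have hc : Continuous fun y : ℝ => Real.exp (-(y ^ 2) / 2) := by fun_prop
  exact intervalIntegral.intervalIntegral_pos_of_pos (hc.intervalIntegrable 0 x)
    (fun y => Real.exp_pos _) hx

theorem hasDerivAt_exp_neg_sq_div_two (x : ℝ) :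
    HasDerivAt (fun y : ℝ => Real.exp (-(y ^ 2) / 2)) (-x * Real.exp (-(x ^ 2) / 2)) x := by
  have h := (((hasDerivAt_id' x).pow 2).neg.div_const 2).exp
  refine h.congr_deriv ?_
  simp
  ring

theorem one_sub_sq_mul_phi_lt {x : ℝ} (hx : 0 < x) :
    (1 - x ^ 2) * phi x < x * Real.exp (-(x ^ 2) / 2) := by
  have hd (y : ℝ) : HasDerivAt
      (fun y : ℝ => y * Real.exp (-(y ^ 2) / 2) - (1 - y ^ 2) * phi y) (2 * y * phi y) y := by
    have h := ((hasDerivAt_id' y).mul (hasDerivAt_exp_neg_sq_div_two y)).sub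
      ((((hasDerivAt_id' y).pow 2).const_sub 1).mul (hasDerivAt_phi y))
    refine h.congr_deriv ?_
    simp
    ring
  have hmono := strictMonoOn_of_deriv_pos (convex_Ici (0 : ℝ))
    (fun y _ => (hd y).continuousAt.continuousWithinAt) (fun y hy => by
      rw [interior_Ici, Set.mem_Ioi] at hy
      rw [(hd y).deriv]
      have := phi_pos hy
      positivity)
  have h := hmono Set.self_mem_Ici hx.le hx
  simpa [phi] using h

theorem hasDerivAt_Afun {x : ℝ} (hx : 0 < x) :
    HasDerivAt Afun ((-x * Real.exp (-(x ^ 2) / 2) * phi x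
      - Real.exp (-(x ^ 2) / 2) * Real.exp (-(x ^ 2) / 2)) / phi x ^ 2) x :=
  (hasDerivAt_exp_neg_sq_div_two x).div (hasDerivAt_phi x) (phi_pos hx).ne'

theorem Afun_add_mul_deriv_neg {x : ℝ} (hx : 0 < x) : Afun x + x * deriv Afun x < 0 := by
  have hp := phi_pos hx
  have he := Real.exp_pos (-(x ^ 2) / 2)
  have h : Afun x + x * deriv Afun x = Real.exp (-(x ^ 2) / 2) / phi x ^ 2 *
      ((1 - x ^ 2) * phi x - x * Real.exp (-(x ^ 2) / 2)) := by
    rw [(hasDerivAt_Afun hx).deriv, Afun]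
    field_simp
    ring
  rw [h]
  exact mul_neg_of_pos_of_neg (by positivity) (sub_neg.2 (one_sub_sq_mul_phi_lt hx))

theorem strictAntiOn_mul_Afun : StrictAntiOn (fun y => y * Afun y) (Set.Ioi 0) := by
  have hd {y : ℝ} (hy : 0 < y) :
      HasDerivAt (fun y => y * Afun y) (1 * Afun y + y * deriv Afun y) y :=
    (hasDerivAt_id' y).mul (hasDerivAt_Afun hy).differentiableAt.hasDerivAt
  refine strictAntiOn_of_deriv_neg (convex_Ioi 0)
    (fun y hy => (hd hy).continuousAt.continuousWithinAt) fun y hy => ?_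
  rw [interior_Ioi, Set.mem_Ioi] at hy
  rw [(hd hy).deriv, one_mul]
  exact Afun_add_mul_deriv_neg hy

theorem strictMonoOn_ba {x : ℝ} (hx : 0 < x) : StrictMonoOn (fun a => ba a x) (Set.Ioi 0) := by
  intro a ha b hb hab
  have hsa : 0 < √a := Real.sqrt_pos.2 ha
  have hsb : 0 < √b := Real.sqrt_pos.2 hb
  have hs : √a < √b := Real.sqrt_lt_sqrt (le_of_lt ha) hab
  have hba (c : ℝ) : ba c x = x / √c * Afun (x / √c) / x := by
    rw [ba]
    field_simp
  simp only [hba]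
  exact div_lt_div_of_pos_right (strictAntiOn_mul_Afun (div_pos hx hsb) (div_pos hx hsa)
    (div_lt_div_of_pos_left hx hsa hs)) hx


/-- for every `y > 0`, `A(y) + y·A′(y) < 0`; consequently for every fixed
`x > 0` the map `a ↦ b_a(x)` is strictly increasing on `(0,∞)`. -/
theorem statement8 :
    (∀ y : ℝ, 0 < y → Afun y + y * deriv Afun y < 0) ∧
    (∀ x : ℝ, 0 < x → StrictMonoOn (fun a => ba a x) (Set.Ioi 0)) := by
  exact ⟨fun _ hy => Afun_add_mul_deriv_neg hy, fun _ hx => strictMonoOn_ba hx⟩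
end

section
/- For every x > 0, the third derivative of log φ at x is strictly positive: (log φ)‴(x) > 0, where φ(x) = ∫_0^x exp(−y²/2) dy. -/
open MeasureTheory Filter Topology

theorem phi_le_self {x : ℝ} (hx : 0 ≤ x) : phi x ≤ x := by
  have hc : Continuous fun y : ℝ => Real.exp (-(y ^ 2) / 2) := by fun_prop
  have h := intervalIntegral.integral_mono_on hx (hc.intervalIntegrable 0 x)
    (intervalIntegrable_const (c := (1 : ℝ)) (μ := volume))
    (fun y _ => Real.exp_le_one_iff.2 (by nlinarith [sq_nonneg y]))
  simpa [phi] using h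

/-- The logarithmic derivative of `phi` on `(0, ∞)`. -/
noncomputable def logDerivPhi (x : ℝ) : ℝ := Real.exp (-(x ^ 2) / 2) / phi x

theorem logDerivPhi_pos {x : ℝ} (hx : 0 < x) : 0 < logDerivPhi x :=
  div_pos (Real.exp_pos _) (phi_pos hx)

theorem inv_le_logDerivPhi_add {x : ℝ} (hx : 0 < x) : x⁻¹ ≤ logDerivPhi x + x / 2 := by
  have hp := phi_pos hx
  have he := Real.exp_pos (-(x ^ 2) / 2)
  have hexp := Real.add_one_le_exp (-(x ^ 2) / 2)
  have key : phi x * (1 - x ^ 2 / 2) ≤ Real.exp (-(x ^ 2) / 2) * x := by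
    rcases le_total (1 - x ^ 2 / 2) 0 with h | h
    · exact (mul_nonpos_of_nonneg_of_nonpos hp.le h).trans (by positivity)
    · calc phi x * (1 - x ^ 2 / 2) ≤ x * (1 - x ^ 2 / 2) := by
            gcongr
            exact phi_le_self hx.le
        _ ≤ x * Real.exp (-(x ^ 2) / 2) := by
            gcongr
            linarith
        _ = _ := mul_comm _ _
  have h : (1 - x ^ 2 / 2) / x ≤ logDerivPhi x := by
    rw [logDerivPhi, div_le_div_iff₀ hx hp]
    linarith
  have hsplit : (1 - x ^ 2 / 2) / x = x⁻¹ - x / 2 := by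
    field_simp
  linarith

theorem hasDerivAt_log_phi {x : ℝ} (hx : 0 < x) :
    HasDerivAt (fun z => Real.log (phi z)) (logDerivPhi x) x :=
  (hasDerivAt_phi x).log (phi_pos hx).ne'

theorem hasDerivAt_logDerivPhi {x : ℝ} (hx : 0 < x) :
    HasDerivAt logDerivPhi (-(logDerivPhi x * (x + logDerivPhi x))) x := by
  have hp := (phi_pos hx).ne'
  have he : HasDerivAt (fun z : ℝ => Real.exp (-(z ^ 2) / 2))
      (Real.exp (-(x ^ 2) / 2) * (-(2 * x) / 2)) x := by
    simpa using (((hasDerivAt_id x).pow 2).neg.div_const 2).exp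
  refine (he.div (hasDerivAt_phi x) hp).congr_deriv ?_
  rw [logDerivPhi]
  field_simp
  ring

/-- for every `x > 0`, the third derivative of `log φ` at `x` is
strictly positive. -/
theorem statement11 (x : ℝ) (hx : 0 < x) :
    0 < iteratedDeriv 3 (fun z => Real.log (phi z)) x := by
  have h₁ : deriv (fun z => Real.log (phi z)) =ᶠ[𝓝 x] logDerivPhi := by
    filter_upwards [lt_mem_nhds hx] with z hz using (hasDerivAt_log_phi hz).deriv
  have h₂ : deriv logDerivPhi =ᶠ[𝓝 x] fun z => -(logDerivPhi z * (z + logDerivPhi z)) := by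
    filter_upwards [lt_mem_nhds hx] with z hz using (hasDerivAt_logDerivPhi hz).deriv
  have hA := hasDerivAt_logDerivPhi hx
  have h₃ := (hA.mul ((hasDerivAt_id x).add hA)).neg
  have heq : iteratedDeriv 3 (fun z => Real.log (phi z)) x =
      logDerivPhi x * ((logDerivPhi x + x) * (2 * logDerivPhi x + x) - 1) := by
    rw [iteratedDeriv_succ, iteratedDeriv_succ, iteratedDeriv_one,
      (h₁.deriv.trans h₂).deriv_eq]
    refine (h₃.congr_deriv ?_).deriv
    simp only [Pi.add_apply, id]
    ring
  rw [heq]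
  refine mul_pos (logDerivPhi_pos hx) ?_
  have hinv := inv_le_logDerivPhi_add hx
  have hx' : 0 < x⁻¹ := inv_pos.2 hx
  have hmul : x * x⁻¹ = 1 := mul_inv_cancel₀ hx.ne'
  have hprod : (x⁻¹ + x / 2) * (2 * x⁻¹) ≤
      (logDerivPhi x + x) * (2 * logDerivPhi x + x) :=
    mul_le_mul (by linarith) (by linarith) (by positivity)
      (by linarith [logDerivPhi_pos hx])
  nlinarith [mul_pos hx' hx']
end

section
/- (Comparison in the parameter a.) Let x > 0, T > 0, let f : [0,T] → ℝ be continuous with f(0) = 0, and let 0 < a′ < a. Suppose x^a, x^{a′} : [0,T] → (0,∞) are continuous functions satisfying the integral equations x^c(t) = x + f(t) + ∫_0^t b_c(x^c(s)) ds for all t ∈ [0,T], for c = a and c = a′. Then x^{a′}(t) ≤ x^a(t) for all t ∈ [0,T]. -/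
open MeasureTheory Filter Topology

theorem continuous_exp_neg_sq_div_two : Continuous fun y : ℝ => Real.exp (-(y ^ 2) / 2) := by
  fun_prop

theorem continuous_phi : Continuous phi :=
  intervalIntegral.continuous_primitive
    (fun _ _ => continuous_exp_neg_sq_div_two.intervalIntegrable _ _) 0

theorem phi_mono : Monotone phi := by
  intro x y hxy
  have h : phi y - phi x = ∫ u in x..y, Real.exp (-(u ^ 2) / 2) :=
    intervalIntegral.integral_interval_sub_left
      (continuous_exp_neg_sq_div_two.intervalIntegrable _ _)
      (continuous_exp_neg_sq_div_two.intervalIntegrable _ _)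
  have h0 : 0 ≤ ∫ u in x..y, Real.exp (-(u ^ 2) / 2) :=
    intervalIntegral.integral_nonneg hxy fun _ _ => (Real.exp_pos _).le
  linarith

theorem phi_div_eq {c : ℝ} (hc : 0 < c) (z : ℝ) :
    phi (z / c) = c⁻¹ * ∫ y in (0:ℝ)..z, Real.exp (-((y / c) ^ 2) / 2) := by
  rw [intervalIntegral.integral_comp_div (fun y => Real.exp (-(y ^ 2) / 2)) hc.ne', zero_div,
    smul_eq_mul, inv_mul_cancel_left₀ hc.ne', phi]

theorem Afun_antitoneOn : AntitoneOn Afun (Set.Ioi 0) := by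
  intro x hx y hy hxy
  rw [Set.mem_Ioi] at hx hy
  unfold Afun
  have hφ := phi_pos hx
  gcongr
  exact phi_mono hxy

theorem continuousOn_Afun : ContinuousOn Afun (Set.Ioi 0) :=
  continuous_exp_neg_sq_div_two.continuousOn.div continuous_phi.continuousOn
    fun _ hx => (phi_pos hx).ne'

theorem ba_antitoneOn {a : ℝ} (ha : 0 < a) : AntitoneOn (ba a) (Set.Ioi 0) := by
  intro x hx y hy hxy
  have hs := Real.sqrt_pos.2 ha
  exact mul_le_mul_of_nonneg_left
    (Afun_antitoneOn (Set.mem_Ioi.2 (div_pos hx hs)) (Set.mem_Ioi.2 (div_pos hy hs))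
      (div_le_div_of_nonneg_right hxy hs.le)) (by positivity)

theorem continuousOn_ba {a : ℝ} (ha : 0 < a) : ContinuousOn (ba a) (Set.Ioi 0) :=
  continuousOn_const.mul <| continuousOn_Afun.comp (by fun_prop)
    fun _ hx => Set.mem_Ioi.2 (div_pos hx (Real.sqrt_pos.2 ha))

theorem ba_eq_div {a : ℝ} (ha : 0 < a) (z : ℝ) :
    ba a z = Real.exp (-((z / √a) ^ 2) / 2) /
      ∫ y in (0:ℝ)..z, Real.exp (-((y / √a) ^ 2) / 2) := by
  have hs := Real.sqrt_pos.2 ha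
  rw [ba, Afun, phi_div_eq hs]
  field_simp

theorem ba_le_ba {a a' z : ℝ} (ha' : 0 < a') (haa : a' ≤ a) (hz : 0 < z) :
    ba a' z ≤ ba a z := by
  have ha := ha'.trans_le haa
  have hcont (c : ℝ) : Continuous fun y : ℝ => Real.exp (-((y / c) ^ 2) / 2) := by fun_prop
  have hpos (c : ℝ) : 0 < ∫ y in (0:ℝ)..z, Real.exp (-((y / c) ^ 2) / 2) :=
    intervalIntegral.intervalIntegral_pos_of_pos ((hcont c).intervalIntegrable _ _)
      (fun _ => Real.exp_pos _) hz
  rw [ba_eq_div ha', ba_eq_div ha, div_le_div_iff₀ (hpos _) (hpos _),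
    ← intervalIntegral.integral_const_mul, ← intervalIntegral.integral_const_mul]
  refine intervalIntegral.integral_mono_on hz.le
    ((continuous_const.mul (hcont _)).intervalIntegrable _ _)
    ((continuous_const.mul (hcont _)).intervalIntegrable _ _) fun y hy => ?_
  rw [← Real.exp_add, ← Real.exp_add, Real.exp_le_exp]
  simp only [div_pow, Real.sq_sqrt ha.le, Real.sq_sqrt ha'.le]
  have hinv : a⁻¹ ≤ a'⁻¹ := inv_anti₀ ha' haa
  have hsq : y ^ 2 ≤ z ^ 2 := pow_le_pow_left₀ hy.1 hy.2 2
  simp only [div_eq_mul_inv]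
  nlinarith [mul_nonneg (sub_nonneg.2 hinv) (sub_nonneg.2 hsq)]

theorem intervalIntegrable_ba_comp {a T s t : ℝ} {g : ℝ → ℝ} (ha : 0 < a)
    (hg : ContinuousOn g (Set.Icc 0 T)) (hpos : ∀ t ∈ Set.Icc (0 : ℝ) T, 0 < g t)
    (hs : s ∈ Set.Icc 0 T) (ht : t ∈ Set.Icc 0 T) :
    IntervalIntegrable (fun r => ba a (g r)) volume s t :=
  (((continuousOn_ba ha).comp hg hpos).mono
    (Set.ordConnected_Icc.uIcc_subset hs ht)).intervalIntegrable

/-- comparison in the parameter `a`. If `0 < a' < a` and `x^a, x^{a'}` are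
positive continuous solutions on `[0,T]` of the integral equations
`x^c(t) = x + f(t) + ∫_0^t b_c(x^c(s)) ds` (for `c = a` and `c = a'`), then
`x^{a'} ≤ x^a` on `[0,T]`. -/
theorem statement15 (x T : ℝ) (hx : 0 < x) (hT : 0 < T)
    (f : ℝ → ℝ) (hf : ContinuousOn f (Set.Icc 0 T)) (hf0 : f 0 = 0)
    (a a' : ℝ) (ha' : 0 < a') (haa : a' < a)
    (xa xa' : ℝ → ℝ)
    (hca : ContinuousOn xa (Set.Icc 0 T)) (hca' : ContinuousOn xa' (Set.Icc 0 T))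
    (hpa : ∀ t ∈ Set.Icc (0 : ℝ) T, 0 < xa t)
    (hpa' : ∀ t ∈ Set.Icc (0 : ℝ) T, 0 < xa' t)
    (heqa : ∀ t ∈ Set.Icc (0 : ℝ) T, xa t = x + f t + ∫ s in (0:ℝ)..t, ba a (xa s))
    (heqa' : ∀ t ∈ Set.Icc (0 : ℝ) T, xa' t = x + f t + ∫ s in (0:ℝ)..t, ba a' (xa' s)) :
    ∀ t ∈ Set.Icc (0 : ℝ) T, xa' t ≤ xa t := by
  intro t ht
  by_contra! hlt
  have h0 : (0 : ℝ) ∈ Set.Icc 0 T := ⟨le_rfl, hT.le⟩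
  have hsub : Set.Icc 0 t ⊆ Set.Icc 0 T := Set.Icc_subset_Icc_right ht.2
  have hcompact : IsCompact (Set.Icc 0 t ∩ (fun s => xa' s - xa s) ⁻¹' Set.Iic 0) :=
    isCompact_Icc.of_isClosed_subset
      (((hca'.sub hca).mono hsub).preimage_isClosed_of_isClosed isClosed_Icc isClosed_Iic)
      Set.inter_subset_left
  have hne : (Set.Icc 0 t ∩ (fun s => xa' s - xa s) ⁻¹' Set.Iic 0).Nonempty :=
    ⟨0, ⟨le_rfl, ht.1⟩, by simp [heqa 0 h0, heqa' 0 h0]⟩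
  obtain ⟨r, ⟨hr, hrle⟩, hmax⟩ := hcompact.exists_isGreatest hne
  have hrT := hsub hr
  have ha := ha'.trans haa
  have hmono : ∫ s in r..t, ba a' (xa' s) ≤ ∫ s in r..t, ba a (xa s) := by
    refine intervalIntegral.integral_mono_on_of_le_Ioo hr.2
      (intervalIntegrable_ba_comp ha' hca' hpa' hrT ht)
      (intervalIntegrable_ba_comp ha hca hpa hrT ht) fun s hs => ?_
    have hst : s ∈ Set.Icc 0 t := ⟨hr.1.trans hs.1.le, hs.2.le⟩
    have hle : xa s ≤ xa' s := by
      by_contra! h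
      exact hs.1.not_ge (hmax ⟨hst, sub_nonpos.2 h.le⟩)
    exact (ba_le_ba ha' haa.le (hpa' s (hsub hst))).trans
      (ba_antitoneOn ha (hpa s (hsub hst)) (hpa' s (hsub hst)) hle)
  have hadd := intervalIntegral.integral_add_adjacent_intervals
    (intervalIntegrable_ba_comp ha hca hpa h0 hrT) (intervalIntegrable_ba_comp ha hca hpa hrT ht)
  have hadd' := intervalIntegral.integral_add_adjacent_intervals
    (intervalIntegrable_ba_comp ha' hca' hpa' h0 hrT)
    (intervalIntegrable_ba_comp ha' hca' hpa' hrT ht)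
  have hrle' : xa' r - xa r ≤ 0 := hrle
  linarith [heqa t ht, heqa' t ht, heqa r hrT, heqa' r hrT]
end

section
/- (Selection of the Skorohod solution on the half line.) Let x > 0 and let f : [0,∞) → ℝ be continuous with f(0) = 0. Suppose that for every a ∈ (0,1] there is a continuous function x^a : [0,∞) → (0,∞) satisfying x^a(t) = x + f(t) + ∫_0^t b_a(x^a(s)) ds for all t ≥ 0, and suppose that for every t ≥ 0 the map a ↦ x^a(t) is nondecreasing on (0,1]. Then for every t ≥ 0 the limit lim_{a→0⁺} x^a(t) exists and equals X^{x,f}(t), the Skorohod reflection of x + f; consequently lim_{a→0⁺} ∫_0^t b_a(x^a(s)) ds = L^{x,f}(t) for every t ≥ 0. -/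
open MeasureTheory Filter Topology

theorem phi_pos_s16 {u : ℝ} (hu : 0 < u) : 0 < phi u :=
  intervalIntegral.intervalIntegral_pos_of_pos
    ((by fun_prop : Continuous fun y : ℝ => Real.exp (-(y ^ 2) / 2)).intervalIntegrable _ _)
    (fun _ => Real.exp_pos _) hu

theorem ba_nonneg {a y : ℝ} (ha : 0 < a) (hy : 0 < y) : 0 ≤ ba a y := by
  have h := phi_pos_s16 (div_pos hy (Real.sqrt_pos.2 ha))
  unfold ba Afun
  positivity

/-- Away from the origin the drift `ba a` is of order `√a`. -/
theorem ba_le {a ε y : ℝ} (ha : 0 < a) (hε : 0 < ε) (haε : Real.sqrt a ≤ ε) (hy : ε ≤ y) :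
    ba a y ≤ 2 * Real.sqrt a / (phi 1 * ε ^ 2) := by
  have hr : 0 < Real.sqrt a := Real.sqrt_pos.2 ha
  unfold ba Afun
  set r := Real.sqrt a
  have hw : 0 < ε / r := div_pos hε hr
  have hu : ε / r ≤ y / r := by gcongr
  have h1 : 1 ≤ y / r := ((one_le_div hr).2 haε).trans hu
  have hexp : Real.exp (-((y / r) ^ 2) / 2) ≤ 2 / (ε / r) ^ 2 := by
    rw [neg_div, Real.exp_neg, ← inv_div ((ε / r) ^ 2)]
    apply inv_anti₀ (by positivity)
    calc (ε / r) ^ 2 / 2 ≤ (y / r) ^ 2 / 2 := by gcongr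
      _ ≤ Real.exp ((y / r) ^ 2 / 2) := by linarith [Real.add_one_le_exp ((y / r) ^ 2 / 2)]
  have hp : 0 < phi 1 := phi_pos_s16 one_pos
  calc 1 / r * (Real.exp (-((y / r) ^ 2) / 2) / phi (y / r))
      ≤ 1 / r * (2 / (ε / r) ^ 2 / phi 1) := by
        gcongr
        exact phi_mono h1
    _ = 2 * r / (phi 1 * ε ^ 2) := by field_simp

/-- The reflection term is the smallest nondecreasing function keeping the path nonnegative. -/
theorem skL_le_s16 {x t : ℝ} {f l : ℝ → ℝ} (ht : 0 ≤ t) (hl : MonotoneOn l (Set.Ici 0))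
    (hl0 : 0 ≤ l 0) (h : ∀ s ∈ Set.Ici (0 : ℝ), 0 ≤ x + f s + l s) : skL x f t ≤ l t := by
  refine csSup_le ((Set.nonempty_Icc.2 ht).image _) ?_
  rintro _ ⟨s, hs, rfl⟩
  have h1 := hl hs.1 ht hs.2
  have h2 := hl Set.self_mem_Ici ht ht
  have h3 := h s hs.1
  exact max_le (by linarith) (hl0.trans h2)

theorem le_skL {x t s : ℝ} {f : ℝ → ℝ} (hf : ContinuousOn f (Set.Ici 0))
    (hs : s ∈ Set.Icc 0 t) : max (-(x + f s)) 0 ≤ skL x f t := by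
  refine le_csSup (isCompact_Icc.bddAbove_image ?_) (Set.mem_image_of_mem _ hs)
  have hf' : ContinuousOn f (Set.Icc 0 t) := hf.mono Set.Icc_subset_Ici_self
  fun_prop

/-- If the drift `b` is at most `δ` wherever the path exceeds `ε`, then its integral exceeds the
reflection term by at most `ε + δ t`. -/
theorem integral_le_skL_add {x t ε δ : ℝ} {f z b : ℝ → ℝ} (hf : ContinuousOn f (Set.Ici 0))
    (ht : 0 ≤ t) (hε : 0 ≤ ε) (hδ : 0 ≤ δ)
    (hz : ContinuousOn z (Set.Ici 0)) (hb : ContinuousOn b (Set.Ici 0))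
    (heq : ∀ s ∈ Set.Ici (0 : ℝ), z s = x + f s + ∫ r in (0:ℝ)..s, b r)
    (hbδ : ∀ s ∈ Set.Ici (0 : ℝ), ε < z s → b s ≤ δ) :
    ∫ r in (0:ℝ)..t, b r ≤ skL x f t + ε + δ * t := by
  have hint {p q : ℝ} (hp : 0 ≤ p) (hpq : p ≤ q) : IntervalIntegrable b volume p q :=
    ContinuousOn.intervalIntegrable_of_Icc hpq
      (hb.mono fun r hr => hp.trans hr.1)
  have hbd {p : ℝ} (hp : 0 ≤ p) (hpt : p ≤ t) (h : ∀ r ∈ Set.Ioo p t, ε < z r) :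
      ∫ r in p..t, b r ≤ δ * (t - p) := by
    have := intervalIntegral.integral_mono_on_of_le_Ioo hpt (hint hp hpt)
      (intervalIntegrable_const (c := δ)) fun r hr =>
        hbδ r (hp.trans hr.1.le) (h r hr)
    rw [intervalIntegral.integral_const, smul_eq_mul] at this
    linarith
  set S : Set ℝ := Set.Icc 0 t ∩ z ⁻¹' Set.Iic ε
  rcases S.eq_empty_or_nonempty with hS | hS
  · have h0 := hbd le_rfl ht fun r hr => by
      by_contra hle
      have hrS : r ∈ S := ⟨⟨hr.1.le, hr.2.le⟩, not_lt.1 hle⟩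
      simp [hS] at hrS
    have h1 := (le_max_right _ _).trans (le_skL (x := x) hf ⟨le_rfl, ht⟩)
    linarith
  · have hSc : IsCompact S := isCompact_Icc.of_isClosed_subset
      ((hz.mono Set.Icc_subset_Ici_self).preimage_isClosed_of_isClosed isClosed_Icc isClosed_Iic)
      Set.inter_subset_left
    obtain ⟨s, ⟨hs, hzs⟩, hmax⟩ := hSc.exists_isGreatest hS
    have h0 := hbd hs.1 hs.2 fun r hr => by
      by_contra hle
      exact absurd (hmax ⟨⟨hs.1.trans hr.1.le, hr.2.le⟩, not_lt.1 hle⟩) (not_le.2 hr.1)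
    have h1 := (le_max_left _ _).trans (le_skL (x := x) hf hs)
    have h2 := heq s hs.1
    have h3 := intervalIntegral.integral_add_adjacent_intervals (hint le_rfl hs.1) (hint hs.1 hs.2)
    have h4 : z s ≤ ε := hzs
    have h5 : 0 ≤ δ * s := mul_nonneg hδ hs.1
    linarith

/-- selection of the Skorohod solution on the half line. If for each
`a ∈ (0,1]` the path `x^a` is a positive continuous solution of
`x^a(t) = x + f(t) + ∫_0^t b_a(x^a(s)) ds` on `[0,∞)`, and for each `t ≥ 0` the map
`a ↦ x^a(t)` is nondecreasing on `(0,1]`, then for every `t ≥ 0`, `x^a(t) → X^{x,f}(t)`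
as `a → 0⁺`, and consequently `∫_0^t b_a(x^a(s)) ds → L^{x,f}(t)`. -/
theorem statement16 (x : ℝ) (hx : 0 < x) (f : ℝ → ℝ)
    (hf : ContinuousOn f (Set.Ici 0)) (hf0 : f 0 = 0)
    (xa : ℝ → ℝ → ℝ)
    (hcont : ∀ a ∈ Set.Ioc (0 : ℝ) 1, ContinuousOn (xa a) (Set.Ici 0))
    (hpos : ∀ a ∈ Set.Ioc (0 : ℝ) 1, ∀ t ∈ Set.Ici (0 : ℝ), 0 < xa a t)
    (heq : ∀ a ∈ Set.Ioc (0 : ℝ) 1, ∀ t ∈ Set.Ici (0 : ℝ),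
      xa a t = x + f t + ∫ s in (0:ℝ)..t, ba a (xa a s))
    (hmono : ∀ t ∈ Set.Ici (0 : ℝ), MonotoneOn (fun a => xa a t) (Set.Ioc 0 1)) :
    ∀ t ∈ Set.Ici (0 : ℝ),
      Tendsto (fun a => xa a t) (nhdsWithin 0 (Set.Ioi 0)) (nhds (skX x f t)) ∧
      Tendsto (fun a => ∫ s in (0:ℝ)..t, ba a (xa a s)) (nhdsWithin 0 (Set.Ioi 0))
        (nhds (skL x f t)) := by
  intro t ht
  have ht' : 0 ≤ t := ht
  have hbc : ∀ a ∈ Set.Ioc (0 : ℝ) 1, ContinuousOn (fun s => ba a (xa a s)) (Set.Ici 0) :=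
    fun a ha => (continuousOn_ba ha.1).comp (hcont a ha) (hpos a ha)
  have hlower : ∀ a ∈ Set.Ioc (0 : ℝ) 1, skL x f t ≤ ∫ s in (0:ℝ)..t, ba a (xa a s) := by
    intro a ha
    refine skL_le_s16 (l := fun t => ∫ s in (0:ℝ)..t, ba a (xa a s)) ht' ?_ (by simp)
      fun s hs => (heq a ha s hs) ▸ (hpos a ha s hs).le
    intro p hp q hq hpq
    have hp' : 0 ≤ p := hp
    refine intervalIntegral.integral_mono_interval le_rfl hp' hpq ?_ ?_
    · filter_upwards [ae_restrict_mem measurableSet_Ioc] with s hs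
      exact ba_nonneg ha.1 (hpos a ha s hs.1.le)
    · exact ContinuousOn.intervalIntegrable_of_Icc hq
        ((hbc a ha).mono Set.Icc_subset_Ici_self)
  have hmem : ∀ᶠ a in 𝓝[>] (0 : ℝ), a ∈ Set.Ioc (0 : ℝ) 1 := Ioc_mem_nhdsGT one_pos
  have hsqrt : Tendsto Real.sqrt (𝓝[>] 0) (𝓝 0) := by
    simpa using (Real.continuous_sqrt.tendsto 0).mono_left nhdsWithin_le_nhds
  have hL : Tendsto (fun a => ∫ s in (0:ℝ)..t, ba a (xa a s)) (𝓝[>] 0) (𝓝 (skL x f t)) := by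
    refine tendsto_order.2 ⟨fun c hc => ?_, fun c hc => ?_⟩
    · filter_upwards [hmem] with a ha using hc.trans_le (hlower a ha)
    · set ε := (c - skL x f t) / 2 with hεdef
      have hε : 0 < ε := by simp only [hεdef]; linarith
      have hδ : Tendsto (fun a => 2 * Real.sqrt a / (phi 1 * ε ^ 2) * t) (𝓝[>] 0) (𝓝 0) := by
        simpa using ((hsqrt.const_mul 2).div_const (phi 1 * ε ^ 2)).mul_const t
      filter_upwards [hmem, hsqrt.eventually_lt_const hε, hδ.eventually_lt_const hε]
        with a ha haε haδ
      have hp := phi_pos_s16 one_pos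
      have := integral_le_skL_add (δ := 2 * Real.sqrt a / (phi 1 * ε ^ 2)) hf ht' hε.le
        (by positivity) (hcont a ha) (hbc a ha) (heq a ha)
        fun s _ hs => ba_le ha.1 hε haε.le hs.le
      linarith
  refine ⟨(hL.const_add (x + f t)).congr' ?_, hL⟩
  filter_upwards [hmem] with a ha using (heq a ha t ht).symm
end
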